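/- A finitely generated group of exponent 3 on m generators has order at most 3^{m + C(m,2) + C(m,3)}, where C denotes binomial coefficients. -/

import Mathlib

theorem ex3_conj {G : Type*} [Group G] (h3 : ∀ g : G, g ^ 3 = 1) (t h : G) :
    t * (h * t * h⁻¹) * (h * h * t * (h * h)⁻¹) = 1 := by
  have a := h3 (t * h)
  have c := h3 h
  simp only [pow_succ, pow_zero, one_mul] at a c
  have e : (h * h)⁻¹ = h := by rw [inv_eq_iff_mul_eq_one, c]
  rw [e, ← a]; simp [mul_assoc]

theorem ex3_comm {G : Type*} [Group G] (h3 : ∀ g : G, g ^ 3 = 1) (t h : G) :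
    (h * t * h⁻¹) * t = t * (h * t * h⁻¹) := by
  have c := h3 h
  simp only [pow_succ, pow_zero, one_mul] at c
  have e : h⁻¹ = h * h := by rw [inv_eq_iff_mul_eq_one, ← mul_assoc, c]
  have a := ex3_conj h3 t h
  have b := ex3_conj h3 t h⁻¹
  rw [show h⁻¹ * h⁻¹ = h by rw [e, ← mul_assoc, c, one_mul], e] at b
  rw [e] at a
  rw [e]
  have e2 : (h * h)⁻¹ = h := by rw [inv_eq_iff_mul_eq_one, c]
  generalize h * h * t * (h * h)⁻¹ = r at *
  generalize h * t * (h * h) = s at *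
  have p : r = (t * s)⁻¹ := by rw [eq_comm, inv_eq_iff_mul_eq_one, a]
  have q : r = (s * t)⁻¹ := by 
    have : t * (r * s) = 1 := by rw [← mul_assoc, b]
    have : (r * s) * t = 1 := by rw [← mul_eq_one_iff_inv_eq.1 this]; simp
    rw [eq_inv_iff_mul_eq_one, ← mul_assoc, this]
  rw [p] at q
  exact (inv_injective q).symm

theorem ringA {E : Type*} [Ring E] (X Y u : E) (hx : X * X = 0) (hy : Y * Y = 0)
    (hxy : (X + Y + X * Y) * (X + Y + X * Y) = 0) (hu : (1 + Y) * u = 1) : X * (Y * X) = 0 := by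
  have hx' : ∀ Z, X * (X * Z) = 0 := fun Z => by rw [← mul_assoc, hx, zero_mul]
  have h := congrArg (X * ·) hxy
  simp only [mul_add, add_mul, mul_assoc, hx, hy, hx', mul_zero, add_zero, zero_add] at h
  have : X * (Y * X) * ((1 + Y) * u) = 0 := by
    rw [← mul_assoc, mul_add, mul_one]
    simp only [mul_assoc]
    rw [h, zero_mul]
  rwa [hu, mul_one] at this

theorem ringB {E : Type*} [Ring E] (X Y : E) (hx : X * X = 0) (hy : Y * Y = 0)
    (hxy : (X + Y + X * Y) * (X + Y + X * Y) = 0) (h1 : X * (Y * X) = 0) (h2 : Y * (X * Y) = 0) :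
    X * Y = - (Y * X) := by
  have hx' : ∀ Z, X * (X * Z) = 0 := fun Z => by rw [← mul_assoc, hx, zero_mul]
  simp only [mul_add, add_mul, mul_assoc, hx, hy, h1, h2, hx', mul_zero, add_zero, zero_add] at hxy
  rw [eq_neg_iff_add_eq_zero, add_comm]; exact hxy

theorem ringC {E : Type*} [Ring E] (hE : (3 : E) = 0) (X Y Z : E) (hx : X * Z = - (Z * X))
    (hy : Y * Z = - (Z * Y)) (h : (X + Y + X * Y) * Z = - (Z * (X + Y + X * Y))) :
    X * (Y * Z) = 0 := by
  have h1 : X * (Y * Z) = Z * (X * Y) := by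
    rw [hy, mul_neg, ← mul_assoc, hx, neg_mul, neg_neg, mul_assoc]
  have h2 : X * (Y * Z) = - (Z * (X * Y)) := by
    rw [add_mul, add_mul, mul_add, mul_add, hx, hy, neg_add, neg_add, mul_assoc] at h
    exact add_left_cancel h
  rw [← h1] at h2
  generalize X * (Y * Z) = w at *
  have h4 : w + w = 0 := by nth_rewrite 1 [h2]; simp
  have h5 : (3 : E) * w = 0 := by rw [hE, zero_mul]
  rw [show (3 : E) = 1 + 1 + 1 by norm_num, add_mul, add_mul, one_mul, h4, zero_add] at h5
  exact h5

theorem ring_part {G E : Type*} [Group G] [Ring E] (hE : (3 : E) = 0) (ρ : G →* E)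
    (hρ : ∀ g, (ρ g - 1) * (ρ g - 1) = 0) :
    (∀ x y, (ρ x - 1) * (ρ y - 1) = - ((ρ y - 1) * (ρ x - 1))) ∧
    (∀ x y z, (ρ x - 1) * ((ρ y - 1) * (ρ z - 1)) = 0) := by
  have e : ∀ x y, ρ (x * y) - 1 = (ρ x - 1) + (ρ y - 1) + (ρ x - 1) * (ρ y - 1) := by
    intro x y; rw [map_mul]; noncomm_ring
  have key : ∀ x y, (ρ x - 1) * ((ρ y - 1) * (ρ x - 1)) = 0 := by
    intro x y
    refine ringA _ _ (ρ y⁻¹) (hρ x) (hρ y) (by rw [← e]; exact hρ _) ?_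
    rw [add_sub_cancel, ← map_mul]; simp
  have anti : ∀ x y, (ρ x - 1) * (ρ y - 1) = - ((ρ y - 1) * (ρ x - 1)) := fun x y =>
    ringB _ _ (hρ x) (hρ y) (by rw [← e]; exact hρ _) (key x y) (key y x)
  exact ⟨anti, fun x y z => ringC hE _ _ _ (anti x z) (anti y z) (by rw [← e]; exact anti _ _)⟩

open Classical in
theorem module_part {G V : Type*} [Group G] [AddCommGroup V] (hV : ∀ v : V, 3 • v = 0)
    (ρ : G →* AddMonoid.End V)
    (hρ : ∀ g, (ρ g - 1) * (ρ g - 1) = 0) (S : Finset G) (t : V) :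
    ∃ W : AddSubgroup V, t ∈ W ∧ (∀ g ∈ S, ∀ w ∈ W, ρ g w ∈ W) ∧
      Finite W ∧ Nat.card W ≤ 3 ^ (1 + S.card + S.card.choose 2) := by
  let _inst : Module (ZMod 3) V := AddCommGroup.zmodModule hV
  have hE : (3 : AddMonoid.End V) = 0 := by
    ext v
    have := hV v
    rw [show (3 : AddMonoid.End V) = 1 + 1 + 1 by norm_num]
    rw [succ_nsmul, succ_nsmul, one_nsmul] at this
    exact this
  obtain ⟨anti, trip⟩ := ring_part hE ρ hρ
  let D : G → AddMonoid.End V := fun g => ρ g - 1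
  have hD : ∀ g v, ρ g v = D g v + v := fun g v => by
    change _ = ρ g v - v + v
    rw [sub_add_cancel]
  have sq : ∀ x v, D x (D x v) = 0 := fun x v => DFunLike.congr_fun (hρ x) v
  have anti' : ∀ x y v, D x (D y v) = - D y (D x v) := fun x y v =>
    DFunLike.congr_fun (anti x y) v
  have trip' : ∀ x y z v, D x (D y (D z v)) = 0 := fun x y z v =>
    DFunLike.congr_fun (trip x y z) v
  have hp : ∀ p : Finset G, ∃ a b, p.card = 2 → p = {a, b} := by
    intro p
    by_cases h : p.card = 2
    · obtain ⟨a, b, -, hab⟩ := Finset.card_eq_two.1 h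
      exact ⟨a, b, fun _ => hab⟩
    · exact ⟨1, 1, fun h' => absurd h' h⟩
  choose a b hab using hp
  let B : Finset V := ({t} ∪ S.image (fun x => D x t)) ∪
    (S.powersetCard 2).image (fun p => D (a p) (D (b p) t))
  have hB : B.card ≤ 1 + S.card + S.card.choose 2 := by
    refine (Finset.card_union_le _ _).trans (add_le_add ((Finset.card_union_le _ _).trans
      (add_le_add (by simp) Finset.card_image_le)) ?_)
    exact Finset.card_image_le.trans (by simp)
  let W := Submodule.span (ZMod 3) (B : Set V)
  have ht : t ∈ W := Submodule.subset_span (by simp [B])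
  have h1 : ∀ x ∈ S, D x t ∈ W := fun x hx => Submodule.subset_span (by
    simp only [B, Finset.coe_union, Finset.coe_image]
    exact Or.inl (Or.inr ⟨x, hx, rfl⟩))
  have h2 : ∀ x ∈ S, ∀ y ∈ S, D x (D y t) ∈ W := by
    intro x hx y hy
    by_cases hxy : x = y
    · subst hxy; rw [sq]; exact W.zero_mem
    have hc : ({x, y} : Finset G).card = 2 := Finset.card_pair hxy
    have hm : D (a {x, y}) (D (b {x, y}) t) ∈ W := Submodule.subset_span (by
      simp only [B, Finset.coe_union, Finset.coe_image]
      refine Or.inr ⟨{x, y}, ?_, rfl⟩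
      simp only [Finset.mem_coe, Finset.mem_powersetCard]
      refine ⟨?_, hc⟩
      intro z hz
      simp only [Finset.mem_insert, Finset.mem_singleton] at hz
      rcases hz with rfl | rfl <;> assumption)
    have he := hab {x, y} hc
    generalize a {x, y} = a' at *
    generalize b {x, y} = b' at *
    have hx' : x = a' ∨ x = b' := by
      have : x ∈ ({x, y} : Finset G) := by simp
      rw [he] at this; simpa using this
    have hy' : y = a' ∨ y = b' := by
      have : y ∈ ({x, y} : Finset G) := by simp
      rw [he] at this; simpa using this
    rcases hx' with rfl | rfl <;> rcases hy' with rfl | rfl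
    · exact absurd rfl hxy
    · exact hm
    · rw [anti']; exact W.neg_mem hm
    · exact absurd rfl hxy
  have stab : ∀ g ∈ S, ∀ w ∈ W, D g w ∈ W := by
    intro g hg w hw
    induction hw using Submodule.span_induction with
    | mem w hw =>
      simp only [B, Finset.coe_union, Finset.coe_image] at hw
      rcases hw with (hw | ⟨x, hx, rfl⟩) | ⟨p, hp, rfl⟩
      · simp at hw; subst hw; exact h1 g hg
      · exact h2 g hg x hx
      · simp only [trip']; exact W.zero_mem
    | zero => rw [map_zero]; exact W.zero_mem
    | add x y _ _ hx hy => rw [map_add]; exact W.add_mem hx hy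
    | smul c x _ hx => rw [ZMod.map_smul]; exact W.smul_mem _ hx
  refine ⟨W.toAddSubgroup, ht, fun g hg w hw => ?_, ?_⟩
  · rw [hD]; exact W.add_mem (stab g hg w hw) hw
  · have : FiniteDimensional (ZMod 3) W := FiniteDimensional.span_finset _ _
    have : Finite W := Module.finite_of_finite (ZMod 3)
    have hc : Nat.card W = 3 ^ Module.finrank (ZMod 3) W := by
      have := Module.natCard_eq_pow_finrank (K := ZMod 3) (V := W)
      simpa using this
    refine ⟨this, ?_⟩
    change Nat.card W ≤ _
    rw [hc]
    exact Nat.pow_le_pow_right (by norm_num) ((finrank_span_finset_le_card B).trans hB)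

theorem conj_comm {G : Type*} [Group G] (h3 : ∀ g : G, g ^ 3 = 1) (t : G)
    (x y : G) (hx : x ∈ Subgroup.normalClosure {t}) (hy : y ∈ Subgroup.normalClosure {t}) :
    x * y = y * x := by
  have := Subgroup.isMulCommutative_closure (k := Group.conjugatesOfSet {t}) (by
    intro x hx y hy
    simp only [Group.mem_conjugatesOfSet_iff, Set.mem_singleton_iff, exists_eq_left] at hx hy
    have : IsConj y x := hy.symm.trans hx
    obtain ⟨c, rfl⟩ := isConj_iff.1 this
    exact ex3_comm h3 y c)
  exact setLike_mul_comm (s := Subgroup.closure (Group.conjugatesOfSet {t})) hx hy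

theorem step {G : Type*} [Group G] (h3 : ∀ g : G, g ^ 3 = 1) (t : G) (S : Finset G) :
    ∃ W : Subgroup G, t ∈ W ∧ (∀ g ∈ S, ∀ w ∈ W, g * w * g⁻¹ ∈ W) ∧
      Finite W ∧ Nat.card W ≤ 3 ^ (1 + S.card + S.card.choose 2) := by
  let M := Subgroup.normalClosure {t}
  let _inst : CommGroup M := { (inferInstance : Group M) with
    mul_comm := fun x y => Subtype.ext (conj_comm h3 t x y x.2 y.2) }
  let ρ : G →* AddMonoid.End (Additive M) :=
    { toFun := fun g => MonoidHom.toAdditive (MulAut.conjNormal g : M ≃* M).toMonoidHom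
      map_one' := by
        apply AddMonoidHom.ext; intro v
        change Additive.ofMul (MulAut.conjNormal (1 : G) v.toMul) = v
        rw [map_one]; rfl
      map_mul' := fun g h => by
        apply AddMonoidHom.ext; intro v
        change Additive.ofMul (MulAut.conjNormal (g * h) v.toMul) = _
        rw [map_mul]; rfl }
  have hc : ∀ (g : G) (v : Additive M), ((ρ g v).toMul : G) = g * (v.toMul : G) * g⁻¹ := by
    intro g v; exact MulAut.conjNormal_apply _ _
  have hV : ∀ v : Additive M, 3 • v = 0 := fun v => by
    apply Additive.toMul.injective
    apply Subtype.ext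
    exact h3 _
  have hρ : ∀ g, (ρ g - 1) * (ρ g - 1) = 0 := by
    intro g
    have hh : ∀ v, v + ρ g v + ρ (g * g) v = 0 := by
      intro v
      apply Additive.toMul.injective
      apply Subtype.ext
      have := ex3_conj h3 (v.toMul : G) g
      rw [← hc, ← hc] at this
      exact this
    apply AddMonoidHom.ext; intro v
    have h1 := hh v
    have h2 := hV (ρ g v)
    rw [map_mul] at h1
    have h1 : v + ρ g v + ρ g (ρ g v) = 0 := h1
    change ρ g (ρ g v - v) - (ρ g v - v) = 0
    rw [map_sub]
    generalize ρ g (ρ g v) = c at *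
    generalize ρ g v = b at *
    have : c - b - (b - v) = (v + b + c) - 3 • b := by abel
    rw [this, h1, h2, sub_zero]
  obtain ⟨W, h1, h2, hf, h4⟩ := module_part hV ρ hρ S
    (Additive.ofMul (⟨t, Subgroup.subset_normalClosure rfl⟩ : M))
  let W' : Subgroup M := AddSubgroup.toSubgroup' W
  refine ⟨W'.map M.subtype, ⟨_, h1, rfl⟩, ?_, ?_⟩
  · rintro g hg _ ⟨w, hw, rfl⟩
    exact ⟨(ρ g (Additive.ofMul w)).toMul, h2 g hg _ hw, hc _ _⟩
  · have hf' : Finite W' := hf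
    refine ⟨Set.Finite.image _ hf', ?_⟩
    rw [Subgroup.card_map_of_injective M.subtype_injective]
    exact h4

theorem stmt6_aux {G : Type*} [Group G] (h3 : ∀ g : G, g ^ 3 = 1) (S : Finset G) :
    Finite (Subgroup.closure (S : Set G)) ∧ Nat.card (Subgroup.closure (S : Set G)) ≤
      3 ^ (S.card + S.card.choose 2 + S.card.choose 3) := by
  classical
  induction S using Finset.induction_on with
  | empty =>
    rw [Finset.coe_empty, Subgroup.closure_empty]
    exact ⟨inferInstance, by simp⟩
  | insert t S ht ih =>
    obtain ⟨W, h1, h2, hf, h4⟩ := step h3 t S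
    have hn : Subgroup.closure (S : Set G) ≤ Subgroup.normalizer (W : Set G) := by
      rw [Subgroup.closure_le]
      intro g hg
      have hc := h3 g
      simp only [pow_succ, pow_zero, one_mul] at hc
      have e : g⁻¹ = g * g := by rw [inv_eq_iff_mul_eq_one, ← mul_assoc, hc]
      have e2 : (g * g)⁻¹ = g := by rw [inv_eq_iff_mul_eq_one, hc]
      rw [SetLike.mem_coe, Subgroup.mem_normalizer_iff]
      intro w
      refine ⟨h2 g hg w, fun hw => ?_⟩
      have := h2 g hg _ (h2 g hg _ hw)
      have e3 : g * (g * (g * w * g⁻¹) * g⁻¹) * g⁻¹ = (g * g * g) * w * (g * g * g)⁻¹ := by group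
      rw [e3, hc] at this
      simpa using this
    have heq : Subgroup.closure ((insert t S : Finset G) : Set G) ≤
        Subgroup.closure (S : Set G) ⊔ W := by
      rw [Subgroup.closure_le]
      intro x hx
      simp only [Finset.coe_insert, Set.mem_insert_iff] at hx
      rcases hx with rfl | hx
      · exact Subgroup.mem_sup_right h1
      · exact Subgroup.mem_sup_left (Subgroup.subset_closure hx)
    obtain ⟨hfH, ih⟩ := ih
    have hmul := Subgroup.coe_mul_of_left_le_normalizer_right _ _ hn
    have hfin : ((Subgroup.closure (S : Set G) ⊔ W : Subgroup G) : Set G).Finite := by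
      rw [hmul]
      exact Set.Finite.mul hfH hf
    refine ⟨hfin.subset heq, ?_⟩
    have hle : Nat.card (Subgroup.closure ((insert t S : Finset G) : Set G)) ≤
        Nat.card (Subgroup.closure (S : Set G) ⊔ W : Subgroup G) := Nat.card_mono hfin heq
    have hle2 : Nat.card (Subgroup.closure (S : Set G) ⊔ W : Subgroup G) ≤
        Nat.card (Subgroup.closure (S : Set G)) * Nat.card W := by
      change Nat.card ((Subgroup.closure (S : Set G) ⊔ W : Subgroup G) : Set G) ≤ _
      rw [hmul]
      exact Set.natCard_mul_le
    refine hle.trans (hle2.trans ((Nat.mul_le_mul ih h4).trans ?_))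
    rw [← pow_add, Finset.card_insert_of_notMem ht, Nat.choose_succ_succ' S.card 1,
      Nat.choose_succ_succ' S.card 2, Nat.choose_one_right]
    apply Nat.pow_le_pow_right (by norm_num)
    norm_num
    omega

/-- Levi–van der Waerden bound: a group of exponent 3 generated by
`m` elements has order at most `3^{m + C(m,2) + C(m,3)}`. -/
theorem stmt6 (G : Type*) [Group G] (m : ℕ) (S : Finset G) (hm : S.card = m)
    (hS : Subgroup.closure (S : Set G) = ⊤)
    (h3 : ∀ g : G, g ^ 3 = 1) :
    Nat.card G ≤ 3 ^ (m + m.choose 2 + m.choose 3) := by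
  have h := (stmt6_aux h3 S).2
  rw [hS, hm, Subgroup.card_top] at h
  exact h
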